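/- arXiv:1210.4692 — 10 statements merged into one kernel-verified Lean document; each statement's English description precedes it below -/
import Mathlib

section
/- Let s : ℕ → ℝ be a sequence with s(i) ∈ {-1, 1} for all i, let w : ℕ → ℝ be a nonnegative summable sequence of weights, and let f : ℕ → ℕ → ℝ be a family of sequences with f(j)(i) ∈ {-1, 1} for all j, i. Suppose that for every j, the sequence s has vanishing correlation with f(j), i.e. (∑_{i<n} f(j)(i)·s(i))/n → 0 as n → ∞. Define F : ℕ → ℝ by F(i) = ∑'_{j} w(j)·f(j)(i). Then s has vanishing correlation with F, i.e. (∑_{i<n} F(i)·s(i))/n → 0 as n → ∞. -/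
open Filter Topology

/-- The Cesàro mean of a sequence bounded by one in absolute value is bounded by one. -/
theorem abs_sum_range_div_le_one {a : ℕ → ℝ} (ha : ∀ i, |a i| ≤ 1) (n : ℕ) :
    |(∑ i ∈ Finset.range n, a i) / (n : ℝ)| ≤ 1 := by
  rw [abs_div, Nat.abs_cast]
  refine div_le_one_of_le₀ ?_ n.cast_nonneg
  calc |∑ i ∈ Finset.range n, a i| ≤ ∑ i ∈ Finset.range n, |a i| :=
        Finset.abs_sum_le_sum_abs _ _
    _ ≤ ∑ _i ∈ Finset.range n, (1 : ℝ) := Finset.sum_le_sum fun i _ => ha i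
    _ = n := by simp

/-- If a ±1-valued sequence `s` has vanishing correlation with each member of a
family of ±1-valued tests `f j`, then it has vanishing correlation with any
nonnegative summable weighted combination `F i = ∑' j, w j * f j i`. -/
theorem vanishing_correlation_of_weighted_sum
    (s : ℕ → ℝ) (hs : ∀ i, s i = -1 ∨ s i = 1)
    (w : ℕ → ℝ) (hw : ∀ j, 0 ≤ w j) (hsum : Summable w)
    (f : ℕ → ℕ → ℝ) (hf : ∀ j i, f j i = -1 ∨ f j i = 1)
    (hcorr : ∀ j, Tendsto (fun n => (∑ i ∈ Finset.range n, f j i * s i) / (n : ℝ))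
      atTop (𝓝 0))
    (F : ℕ → ℝ) (hF : ∀ i, F i = ∑' j, w j * f j i) :
    Tendsto (fun n => (∑ i ∈ Finset.range n, F i * s i) / (n : ℝ)) atTop (𝓝 0) := by
  have hfabs : ∀ j i, |f j i| = 1 := fun j i => by rcases hf j i with h | h <;> simp [h]
  have hsabs : ∀ i, |s i| = 1 := fun i => by rcases hs i with h | h <;> simp [h]
  have hsummable : ∀ i, Summable fun j => w j * f j i := fun i =>
    Summable.of_norm_bounded hsum fun j => by
      rw [Real.norm_eq_abs, abs_mul, hfabs, mul_one, abs_of_nonneg (hw j)]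
  have hexchange : ∀ n : ℕ, (∑ i ∈ Finset.range n, F i * s i) / (n : ℝ) =
      ∑' j, w j * ((∑ i ∈ Finset.range n, f j i * s i) / (n : ℝ)) := by
    intro n
    simp_rw [hF, ← tsum_mul_right]
    rw [← Summable.tsum_finsetSum fun i _ => (hsummable i).mul_right (s i), ← tsum_div_const]
    refine tsum_congr fun j => ?_
    rw [← mul_div_assoc, Finset.mul_sum]
    simp_rw [mul_assoc]
  simp_rw [hexchange]
  have hlim : Tendsto
      (fun n : ℕ => ∑' j, w j * ((∑ i ∈ Finset.range n, f j i * s i) / (n : ℝ)))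
      atTop (𝓝 (∑' j, w j * 0)) := by
    refine tendsto_tsum_of_dominated_convergence hsum (fun j => (hcorr j).const_mul (w j))
      (Eventually.of_forall fun n j => ?_)
    rw [Real.norm_eq_abs, abs_mul, abs_of_nonneg (hw j)]
    refine mul_le_of_le_one_right (hw j) (abs_sum_range_div_le_one (fun i => ?_) n)
    rw [abs_mul, hfabs, hsabs, mul_one]
  simpa using hlim
end

section
/- Let s : ℕ → ℝ be a sequence with s(i) ∈ {-1, 1} for all i, and let A ⊆ ℕ be a set such that s(i) = 1 for every i ∈ A. Let f_A : ℕ → ℝ be defined by f_A(i) = 1 if i ∈ A and f_A(i) = -1 otherwise. Suppose that (∑_{i<n} s(i))/n → 0 and (∑_{i<n} f_A(i)·s(i))/n → 0 as n → ∞. Then the density of A tends to 0, i.e. |A ∩ [0, n)|/n → 0 as n → ∞; in particular A does not have positive density. -/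
open Filter Topology

/-- If the ±1 indicator sequence `s` of a pseudorandom set is uncorrelated with
the constant test `1` and with the ±1 indicator test of a set `A` contained in
`{i | s i = 1}`, then `A` has density 0. -/
theorem density_zero_of_uncorrelated_subset
    (s : ℕ → ℝ) (hs : ∀ i, s i = -1 ∨ s i = 1)
    (A : Set ℕ) [DecidablePred (· ∈ A)] (hA : ∀ i ∈ A, s i = 1)
    (fA : ℕ → ℝ) (hfA : ∀ i, fA i = if i ∈ A then 1 else -1)
    (h1 : Tendsto (fun n => (∑ i ∈ Finset.range n, s i) / (n : ℝ)) atTop (𝓝 0))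
    (h2 : Tendsto (fun n => (∑ i ∈ Finset.range n, fA i * s i) / (n : ℝ)) atTop (𝓝 0)) :
    Tendsto (fun n => (((Finset.range n).filter (· ∈ A)).card : ℝ) / (n : ℝ))
      atTop (𝓝 0) := by
  have h := (h1.add h2).div_const 2
  simp only [add_zero, zero_div] at h
  refine h.congr fun n => ?_
  have key : ∑ i ∈ Finset.range n, s i + ∑ i ∈ Finset.range n, fA i * s i
      = 2 * (((Finset.range n).filter (· ∈ A)).card : ℝ) := by
    rw [← Finset.sum_add_distrib, Finset.natCast_card_filter, Finset.mul_sum]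
    refine Finset.sum_congr rfl fun i _ => ?_
    rw [hfA i]
    split_ifs with hi
    · rw [hA i hi]; norm_num
    · ring
  rw [← add_div, key]
  ring
end

section
/- Let 0 < p < 1 be a real number, let s : ℕ → ℝ be a sequence with s(i) ∈ {-1, 1} for all i, and define t : ℕ → ℝ by t(i) = (s(i) - 1)/2 + p. Let A ⊆ ℕ be a set such that s(i) = 1 for every i ∈ A, and let f_A : ℕ → ℝ be defined by f_A(i) = 1 if i ∈ A and f_A(i) = -1 otherwise. Suppose that (∑_{i<n} t(i))/n → 0 and (∑_{i<n} f_A(i)·t(i))/n → 0 as n → ∞. Then |A ∩ [0, n)|/n → 0 as n → ∞. -/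
open Filter Topology

/-- The `p`-biased version: if the shifted indicator `t i = (s i - 1)/2 + p` of a
`p`-biased pseudorandom set is uncorrelated with the constant test and with the
±1 indicator test of a set `A` contained in `{i | s i = 1}`, then `A` has
density 0. -/
theorem density_zero_of_uncorrelated_subset_biased
    (p : ℝ) (hp0 : 0 < p) (hp1 : p < 1)
    (s : ℕ → ℝ) (hs : ∀ i, s i = -1 ∨ s i = 1)
    (t : ℕ → ℝ) (ht : ∀ i, t i = (s i - 1) / 2 + p)
    (A : Set ℕ) [DecidablePred (· ∈ A)] (hA : ∀ i ∈ A, s i = 1)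
    (fA : ℕ → ℝ) (hfA : ∀ i, fA i = if i ∈ A then 1 else -1)
    (h1 : Tendsto (fun n => (∑ i ∈ Finset.range n, t i) / (n : ℝ)) atTop (𝓝 0))
    (h2 : Tendsto (fun n => (∑ i ∈ Finset.range n, fA i * t i) / (n : ℝ)) atTop (𝓝 0)) :
    Tendsto (fun n => (((Finset.range n).filter (· ∈ A)).card : ℝ) / (n : ℝ))
      atTop (𝓝 0) := by
  have key : ∀ n : ℕ, ∑ i ∈ Finset.range n, t i + ∑ i ∈ Finset.range n, fA i * t i =
      2 * p * (((Finset.range n).filter (· ∈ A)).card : ℝ) := by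
    intro n
    rw [← Finset.sum_add_distrib, ← Finset.sum_boole, Finset.mul_sum]
    refine Finset.sum_congr rfl fun i _ => ?_
    rw [hfA]
    split_ifs with hi
    · rw [ht, hA i hi]
      ring
    · ring
  have hlim := (h1.add h2).div_const (2 * p)
  rw [add_zero, zero_div] at hlim
  refine hlim.congr fun n => ?_
  rw [← add_div, key, div_right_comm, mul_div_cancel_left₀ _ (by positivity)]
end

section
/- Let λ denote the Liouville function, λ(i) = (-1)^{Ω(i)} where Ω(i) is the number of prime factors of i counted with multiplicity, and let μ denote the Möbius function. Let f : ℕ → ℝ satisfy |f(i)| ≤ 1 for all i. Suppose that for every k ≥ 1, (1/n)·∑_{m : 1 ≤ m ≤ n/k², m squarefree} f(k²·m)·μ(m) → 0 as n → ∞. Then (1/n)·∑_{i=1}^{n} f(i)·λ(i) → 0 as n → ∞. -/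
open Filter Topology

/-- If the square of `a` divides `b ^ 2 * m` with `m` squarefree, then `a` divides `b`. -/
theorem Nat.dvd_of_sq_dvd_sq_mul_squarefree {a b m : ℕ} (hb : b ≠ 0) (hm : Squarefree m)
    (h : a ^ 2 ∣ b ^ 2 * m) : a ∣ b := by
  have hm0 : m ≠ 0 := hm.ne_zero
  have hbm : b ^ 2 * m ≠ 0 := by positivity
  have ha : a ≠ 0 := by
    rintro rfl
    exact hbm (by simpa using h)
  rw [← Nat.factorization_le_iff_dvd ha hb]
  intro p
  have h1 := (Nat.factorization_le_iff_dvd (pow_ne_zero 2 ha) hbm).2 h p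
  have h2 := hm.natFactorization_le_one p
  rw [Nat.factorization_mul (pow_ne_zero 2 hb) hm0] at h1
  simp only [Nat.factorization_pow, Finsupp.add_apply, Finsupp.smul_apply, smul_eq_mul] at h1
  omega

theorem Nat.eq_of_sq_mul_squarefree_eq {a b m l : ℕ} (ha : a ≠ 0) (hb : b ≠ 0)
    (hm : Squarefree m) (hl : Squarefree l) (h : a ^ 2 * m = b ^ 2 * l) : a = b ∧ m = l := by
  have hab : a = b := Nat.dvd_antisymm
    (Nat.dvd_of_sq_dvd_sq_mul_squarefree hb hl (h ▸ Nat.dvd_mul_right _ _))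
    (Nat.dvd_of_sq_dvd_sq_mul_squarefree ha hm (h ▸ Nat.dvd_mul_right _ _))
  subst hab
  exact ⟨rfl, Nat.eq_of_mul_eq_mul_left (by positivity) h⟩

/-- Summation over `1 ≤ i ≤ n` arranged according to the decomposition `i = k ^ 2 * m` with `m`
squarefree. -/
theorem sum_Icc_eq_sum_sq_mul_squarefree {M : Type*} [AddCommMonoid M] (F : ℕ → M) (n : ℕ) :
    ∑ i ∈ Finset.Icc 1 n, F i = ∑ k ∈ Finset.range n,
      ∑ m ∈ (Finset.Icc 1 n).filter (fun m => Squarefree m ∧ (k + 1) ^ 2 * m ≤ n),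
        F ((k + 1) ^ 2 * m) := by
  rw [Finset.sum_sigma']
  symm
  refine Finset.sum_bij (fun x _ => (x.1 + 1) ^ 2 * x.2) ?_ ?_ ?_ (fun _ _ => rfl)
  · rintro ⟨k, m⟩ hx
    simp only [Finset.mem_sigma, Finset.mem_filter, Finset.mem_Icc] at hx ⊢
    exact ⟨Nat.mul_pos (by positivity) hx.2.1.1, hx.2.2.2⟩
  · rintro ⟨k, m⟩ hx ⟨l, r⟩ hy hxy
    simp only [Finset.mem_sigma, Finset.mem_filter] at hx hy
    obtain ⟨hkl, rfl⟩ := Nat.eq_of_sq_mul_squarefree_eq k.succ_ne_zero l.succ_ne_zero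
      hx.2.2.1 hy.2.2.1 hxy
    obtain rfl : k = l := Nat.succ_injective hkl
    rfl
  · intro i hi
    rw [Finset.mem_Icc] at hi
    obtain ⟨m, k, rfl, hm⟩ := Nat.sq_mul_squarefree_of_pos' hi.1
    have hle : (k + 1) ≤ (k + 1) ^ 2 * (m + 1) := by nlinarith [Nat.zero_le (k * m)]
    have hle' : (m + 1) ≤ (k + 1) ^ 2 * (m + 1) := Nat.le_mul_of_pos_left _ (by positivity)
    refine ⟨⟨k, m + 1⟩, ?_, rfl⟩
    simp only [Finset.mem_sigma, Finset.mem_filter, Finset.mem_Icc, Finset.mem_range]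
    exact ⟨by omega, ⟨by omega, by omega⟩, hm, hi.2⟩

theorem cardFactors_sq_mul_parity {k m : ℕ} (hk : k ≠ 0) (hm : Squarefree m) :
    (-1 : ℝ) ^ ArithmeticFunction.cardFactors (k ^ 2 * m) = (ArithmeticFunction.moebius m : ℝ) := by
  rw [ArithmeticFunction.cardFactors_mul (pow_ne_zero 2 hk) hm.ne_zero,
    ArithmeticFunction.cardFactors_pow, ArithmeticFunction.moebius_apply_of_squarefree hm,
    pow_add, pow_mul]
  simp

theorem abs_moebius_piece_le {f : ℕ → ℝ} (hf : ∀ i, |f i| ≤ 1) {k : ℕ} (hk : 0 < k) (n : ℕ) :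
    |(∑ m ∈ (Finset.Icc 1 n).filter (fun m => Squarefree m ∧ k ^ 2 * m ≤ n),
      f (k ^ 2 * m) * (ArithmeticFunction.moebius m : ℝ)) / (n : ℝ)| ≤ 1 / (k : ℝ) ^ 2 := by
  set s := (Finset.Icc 1 n).filter (fun m => Squarefree m ∧ k ^ 2 * m ≤ n) with hs
  have hcard : (s.card : ℝ) ≤ (n : ℝ) / (k : ℝ) ^ 2 := by
    have hsub : s ⊆ Finset.Icc 1 (n / k ^ 2) := by
      intro m hm
      simp only [hs, Finset.mem_filter, Finset.mem_Icc] at hm ⊢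
      exact ⟨hm.1.1, (Nat.le_div_iff_mul_le (by positivity)).2 (by linarith [hm.2.2])⟩
    calc (s.card : ℝ) ≤ ((n / k ^ 2 : ℕ) : ℝ) := by
          exact_mod_cast (Finset.card_le_card hsub).trans_eq (by simp)
      _ ≤ (n : ℝ) / (k : ℝ) ^ 2 := by exact_mod_cast Nat.cast_div_le (α := ℝ)
  have hsum : |∑ m ∈ s, f (k ^ 2 * m) * (ArithmeticFunction.moebius m : ℝ)| ≤ s.card := by
    refine (Finset.abs_sum_le_sum_abs _ _).trans ?_
    refine (Finset.sum_le_card_nsmul _ _ 1 fun m _ => ?_).trans_eq (by simp)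
    rw [abs_mul]
    refine mul_le_one₀ (hf _) (abs_nonneg _) ?_
    exact_mod_cast ArithmeticFunction.abs_moebius_le_one
  rw [abs_div, Nat.abs_cast]
  refine div_le_of_le_mul₀ (by positivity) (by positivity) ((hsum.trans hcard).trans_eq ?_)
  ring

/-- If for every `k ≥ 1` the averaged correlation of the modified test
`m ↦ f (k² m)` with the Möbius function over squarefree `m ≤ n / k²` vanishes,
then the averaged correlation of the bounded test `f` with the Liouville
function `λ i = (-1) ^ Ω i` vanishes. -/
theorem liouville_uncorrelated_of_moebius_pieces
    (f : ℕ → ℝ) (hf : ∀ i, |f i| ≤ 1)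
    (h : ∀ k : ℕ, 1 ≤ k →
      Tendsto (fun n =>
        (∑ m ∈ (Finset.Icc 1 n).filter (fun m => Squarefree m ∧ k ^ 2 * m ≤ n),
          f (k ^ 2 * m) * (ArithmeticFunction.moebius m : ℝ)) / (n : ℝ))
        atTop (𝓝 0)) :
    Tendsto (fun n =>
      (∑ i ∈ Finset.Icc 1 n, f i * (-1 : ℝ) ^ (ArithmeticFunction.cardFactors i)) / (n : ℝ))
      atTop (𝓝 0) := by
  have hsummable : Summable fun k : ℕ => 1 / ((k + 1 : ℕ) : ℝ) ^ 2 :=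
    (summable_nat_add_iff 1).2 (Real.summable_one_div_nat_pow.2 one_lt_two)
  have hlim := tendsto_tsum_of_dominated_convergence hsummable
    (fun k => h (k + 1) (Nat.le_add_left 1 k))
    (Eventually.of_forall fun n k => abs_moebius_piece_le hf k.succ_pos n)
  rw [tsum_zero] at hlim
  refine hlim.congr fun n => ?_
  rw [sum_Icc_eq_sum_sq_mul_squarefree, Finset.sum_div, tsum_eq_sum (s := Finset.range n)]
  · refine Finset.sum_congr rfl fun k _ => ?_
    congr 1
    refine Finset.sum_congr rfl fun m hm => ?_
    rw [cardFactors_sq_mul_parity k.succ_ne_zero (Finset.mem_filter.1 hm).2.1]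
  · intro k hk
    rw [Finset.mem_range, not_lt] at hk
    rw [Finset.filter_false_of_mem, Finset.sum_empty, zero_div]
    rintro m hm ⟨-, hle⟩
    have hm1 := (Finset.mem_Icc.1 hm).1
    nlinarith [Nat.mul_le_mul_left ((k + 1) ^ 2) hm1]
end

section
/- Let λ(i) = (-1)^{Ω(i)} be the Liouville function and μ the Möbius function. Let f : ℕ → ℝ with f(i) ∈ {-1,1} for all i, and let ε > 0. Assume (1/n)·∑_{i=1}^{n} f(i)·μ(i) → ε and (1/n)·∑_{i=1}^{n} f(i)·λ(i) → 0 as n → ∞. Let n₀ ≥ 1 be such that ∑_{k > n₀} 1/k² < ε/2, and define g : ℕ → ℝ by g(i) = -f(i) if i is divisible by k² for some k with 2 ≤ k ≤ n₀, and g(i) = f(i) otherwise. Then liminf_{n→∞} (1/n)·∑_{i=1}^{n} g(i)·λ(i) > 0. -/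
open Filter Topology

/-- The integers in `[1, n]` divisible by some `k ^ 2` with `m < k` number at most
`n * ∑_{k > m} 1 / k ^ 2`. -/
theorem card_filter_exists_sq_dvd_le (m n : ℕ)
    [DecidablePred fun i : ℕ => ∃ k, m < k ∧ k ^ 2 ∣ i] :
    (((Finset.Icc 1 n).filter (fun i => ∃ k, m < k ∧ k ^ 2 ∣ i)).card : ℝ) ≤
      n * ∑' k : {k : ℕ // m < k}, (1 : ℝ) / ((k : ℕ) : ℝ) ^ 2 := by
  have hsub : (Finset.Icc 1 n).filter (fun i => ∃ k, m < k ∧ k ^ 2 ∣ i) ⊆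
      (Finset.Ioc m n).biUnion fun k => (Finset.Ioc 0 n).filter fun i => k ^ 2 ∣ i := by
    intro i hi
    simp only [Finset.mem_filter, Finset.mem_Icc, Finset.mem_biUnion, Finset.mem_Ioc] at hi ⊢
    obtain ⟨⟨hi1, hin⟩, k, hk, hdvd⟩ := hi
    have hle := Nat.le_of_dvd hi1 hdvd
    exact ⟨k, ⟨hk, by nlinarith⟩, ⟨hi1, hin⟩, hdvd⟩
  have hcard := (Finset.card_le_card hsub).trans Finset.card_biUnion_le
  simp only [Nat.Ioc_filter_dvd_card_eq_div] at hcard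
  have hsummable : Summable fun k : {k : ℕ // m < k} => (1 : ℝ) / ((k : ℕ) : ℝ) ^ 2 :=
    (Real.summable_one_div_nat_pow.mpr one_lt_two).subtype {k | m < k}
  calc (((Finset.Icc 1 n).filter (fun i => ∃ k, m < k ∧ k ^ 2 ∣ i)).card : ℝ)
      ≤ ∑ k ∈ Finset.Ioc m n, ((n / k ^ 2 : ℕ) : ℝ) := by exact_mod_cast hcard
    _ ≤ ∑ k ∈ Finset.Ioc m n, (n : ℝ) * (1 / (k : ℝ) ^ 2) := by
        refine Finset.sum_le_sum fun k _ => Nat.cast_div_le.trans (le_of_eq ?_)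
        push_cast
        ring
    _ = n * ∑ k ∈ (Finset.Ioc m n).subtype (m < ·), (1 : ℝ) / ((k : ℕ) : ℝ) ^ 2 := by
        rw [← Finset.mul_sum, Finset.sum_subtype_of_mem (fun k : ℕ => (1 : ℝ) / (k : ℝ) ^ 2)
          fun k hk => (Finset.mem_Ioc.mp hk).1]
    _ ≤ _ := by
        gcongr
        exact hsummable.sum_le_tsum _ fun _ _ => by positivity

/-- A natural number that is not squarefree is divisible by `k ^ 2` for some `2 ≤ k`. -/
theorem exists_two_le_sq_dvd_of_not_squarefree {i : ℕ} (h : ¬ Squarefree i) :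
    ∃ k, 2 ≤ k ∧ k ^ 2 ∣ i := by
  rw [Nat.squarefree_iff_prime_squarefree] at h
  push Not at h
  obtain ⟨p, hp, hdvd⟩ := h
  exact ⟨p, hp.two_le, by rwa [sq]⟩

/-- If a ±1 test `f` correlates with the Möbius function with limit `ε > 0` while
being uncorrelated with the Liouville function `λ i = (-1) ^ Ω i`, then the test
`g`, obtained from `f` by flipping signs on numbers divisible by `k²` for some
`2 ≤ k ≤ n₀` (where `∑_{k > n₀} 1/k² < ε/2`), correlates positively with `λ`. -/
theorem modified_test_correlates_with_liouville
    (f : ℕ → ℝ) (hf : ∀ i, f i = -1 ∨ f i = 1) (ε : ℝ) (hε : 0 < ε)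
    (hμ : Tendsto (fun n =>
        (∑ i ∈ Finset.Icc 1 n, f i * (ArithmeticFunction.moebius i : ℝ)) / (n : ℝ))
      atTop (𝓝 ε))
    (hLiou : Tendsto (fun n =>
        (∑ i ∈ Finset.Icc 1 n, f i * (-1 : ℝ) ^ (ArithmeticFunction.cardFactors i)) / (n : ℝ))
      atTop (𝓝 0))
    (n₀ : ℕ) (hn₀ : 1 ≤ n₀)
    (htail : ∑' k : {k : ℕ // n₀ < k}, (1 : ℝ) / ((k : ℕ) : ℝ) ^ 2 < ε / 2)
    (g : ℕ → ℝ)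
    (hg1 : ∀ i, (∃ k, 2 ≤ k ∧ k ≤ n₀ ∧ k ^ 2 ∣ i) → g i = -f i)
    (hg2 : ∀ i, (¬ ∃ k, 2 ≤ k ∧ k ≤ n₀ ∧ k ^ 2 ∣ i) → g i = f i) :
    0 < Filter.liminf (fun n =>
        (∑ i ∈ Finset.Icc 1 n, g i * (-1 : ℝ) ^ (ArithmeticFunction.cardFactors i)) / (n : ℝ))
      atTop := by
  classical
  set T := ∑' k : {k : ℕ // n₀ < k}, (1 : ℝ) / ((k : ℕ) : ℝ) ^ 2
  set L : ℕ → ℝ := fun i => (-1 : ℝ) ^ (ArithmeticFunction.cardFactors i) with hL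
  change Tendsto (fun n => (∑ i ∈ Finset.Icc 1 n, f i * L i) / (n : ℝ)) atTop (𝓝 0) at hLiou
  change 0 < liminf (fun n => (∑ i ∈ Finset.Icc 1 n, g i * L i) / (n : ℝ)) atTop
  have habs : ∀ i, |f i * L i| = 1 := fun i => by
    rcases hf i with h | h <;> simp [hL, h]
  have hle_one : ∀ i, g i * L i ≤ 1 := fun i => by
    by_cases h : ∃ k, 2 ≤ k ∧ k ≤ n₀ ∧ k ^ 2 ∣ i
    · rw [hg1 i h, neg_mul]
      exact (neg_le_abs _).trans (habs i).le
    · rw [hg2 i h]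
      exact (le_abs_self _).trans (habs i).le
  have hpointwise : ∀ i, i ≠ 0 →
      2 * (f i * (ArithmeticFunction.moebius i : ℝ)) - f i * L i -
        2 * (if ∃ k, n₀ < k ∧ k ^ 2 ∣ i then 1 else 0) ≤ g i * L i := by
    intro i hi
    by_cases hsq : Squarefree i
    · have hgi : g i = f i := hg2 i fun ⟨k, hk, _, hdvd⟩ => by
        have := Nat.isUnit_iff.mp (hsq k (by rwa [← sq]))
        omega
      have hμi : (ArithmeticFunction.moebius i : ℝ) = L i := by
        simp [hL, ArithmeticFunction.moebius_apply_of_squarefree hsq]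
      rw [hgi, hμi]
      split_ifs <;> linarith
    · rw [ArithmeticFunction.moebius_eq_zero_of_not_squarefree hsq]
      by_cases h : ∃ k, 2 ≤ k ∧ k ≤ n₀ ∧ k ^ 2 ∣ i
      · rw [hg1 i h]
        split_ifs <;> simp
      · obtain ⟨k, hk, hdvd⟩ := exists_two_le_sq_dvd_of_not_squarefree hsq
        have hlarge : ∃ k, n₀ < k ∧ k ^ 2 ∣ i :=
          ⟨k, not_le.mp fun hkn => h ⟨k, hk, hkn, hdvd⟩, hdvd⟩
        rw [hg2 i h, if_pos hlarge]
        have := (abs_le.mp (habs i).le).1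
        push_cast
        linarith
  have hlim := (hμ.const_mul 2).sub hLiou
  have hbound : ∀ᶠ n : ℕ in atTop, ε / 2 ≤ (∑ i ∈ Finset.Icc 1 n, g i * L i) / (n : ℝ) := by
    filter_upwards [hlim.eventually (lt_mem_nhds (show 2 * ε - ε / 2 < 2 * ε - 0 by linarith)),
      eventually_gt_atTop 0] with n hn hn0
    have hn0' : (0 : ℝ) < n := by exact_mod_cast hn0
    have hsum := Finset.sum_le_sum fun i (hi : i ∈ Finset.Icc 1 n) =>
      hpointwise i (Nat.one_le_iff_ne_zero.mp (Finset.mem_Icc.mp hi).1)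
    rw [Finset.sum_sub_distrib, Finset.sum_sub_distrib, ← Finset.mul_sum, ← Finset.mul_sum,
      Finset.sum_boole] at hsum
    have hcard := card_filter_exists_sq_dvd_le n₀ n
    rw [← mul_div_assoc, ← sub_div, lt_div_iff₀ hn0'] at hn
    rw [le_div_iff₀ hn0']
    have hT : (n : ℝ) * T ≤ n * (ε / 2) := by gcongr
    linarith
  have hcobdd : IsCoboundedUnder (· ≥ ·) atTop fun n : ℕ =>
      (∑ i ∈ Finset.Icc 1 n, g i * L i) / (n : ℝ) := by
    refine (isBoundedUnder_of ⟨1, fun n => ?_⟩ : IsBoundedUnder (· ≤ ·) atTop _).isCoboundedUnder_ge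
    refine div_le_one_of_le₀ ?_ n.cast_nonneg
    simpa using Finset.sum_le_sum fun i (_ : i ∈ Finset.Icc 1 n) => hle_one i
  exact (half_pos hε).trans_le (le_liminf_of_le hcobdd hbound)
end

section
/- Let X : ℕ → Set ℕ be a countable family of sets of natural numbers (with decidable membership). Then there exists a strictly monotone function k : ℕ → ℕ such that for every j, the sequence of relative densities n ↦ |X(j) ∩ [0, k(n))| / k(n) converges to some real limit as n → ∞. -/
open Filter Topology

/-- For any countable family of sets of naturals there is an infinite set
`K = {k 0 < k 1 < …}` along which every member of the family has a well-defined
`K`-density. -/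
theorem exists_common_density_subsequence
    (X : ℕ → Set ℕ) [∀ j, DecidablePred (· ∈ X j)] :
    ∃ k : ℕ → ℕ, StrictMono k ∧ ∀ j, ∃ L : ℝ,
      Tendsto (fun n => (((Finset.range (k n)).filter (· ∈ X j)).card : ℝ) / (k n : ℝ))
        atTop (𝓝 L) := by
  have hK : IsCompact (Set.univ.pi fun _ : ℕ => Set.Icc (0 : ℝ) 1) :=
    isCompact_univ_pi fun _ => isCompact_Icc
  obtain ⟨a, -, k, hk, hlim⟩ := hK.tendsto_subseq
    (x := fun n j => (((Finset.range n).filter (· ∈ X j)).card : ℝ) / (n : ℝ))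
    (fun n j _ => ⟨by positivity, div_le_one_of_le₀
      (by exact_mod_cast (Finset.card_filter_le _ _).trans_eq (Finset.card_range n))
      n.cast_nonneg⟩)
  exact ⟨k, hk, fun j => ⟨a j, tendsto_pi_nhds.1 hlim j⟩⟩
end

section
/- Let m : Set ℕ → ℝ be a finitely additive probability measure on all subsets of ℕ: m(∅) = 0, m(ℕ) = 1, m(A) ≥ 0 for all A, and m(A ∪ B) = m(A) + m(B) whenever A and B are disjoint. Let Ω = {U : ultrafilter on ℕ | m(V) > 0 for every V ∈ U}, and for X ⊆ ℕ let Ω[X] = {U ∈ Ω | X ∈ U}. Then for all X, Y ⊆ ℕ: Ω[X] = Ω[Y] if and only if m(X △ Y) = 0, where X △ Y is the symmetric difference. -/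
open Filter

/-- `OmegaSet m X` is the set `Ω[X]` of ultrafilters on `ℕ` all of whose members
have positive `m`-measure and which contain `X`. -/
def OmegaSet (m : Set ℕ → ℝ) (X : Set ℕ) : Set (Ultrafilter ℕ) :=
  {U : Ultrafilter ℕ | (∀ V ∈ (U : Filter ℕ), 0 < m V) ∧ X ∈ U}

section FinitelyAdditive

variable {α : Type*} {m : Set α → ℝ}

theorem finitelyAdditive_mono (hnonneg : ∀ A : Set α, 0 ≤ m A)
    (hadd : ∀ A B : Set α, Disjoint A B → m (A ∪ B) = m A + m B)
    {A B : Set α} (h : A ⊆ B) : m A ≤ m B := by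
  have h' := hadd A (B \ A) Set.disjoint_sdiff_right
  rw [Set.union_sdiff_cancel h] at h'
  linarith [hnonneg (B \ A)]

theorem finitelyAdditive_union_null (hnonneg : ∀ A : Set α, 0 ≤ m A)
    (hadd : ∀ A B : Set α, Disjoint A B → m (A ∪ B) = m A + m B)
    {A B : Set α} (hA : m A = 0) (hB : m B = 0) : m (A ∪ B) = 0 := by
  have h := hadd A (B \ A) Set.disjoint_sdiff_right
  rw [Set.union_sdiff_self] at h
  linarith [hnonneg (B \ A),
    finitelyAdditive_mono hnonneg hadd (Set.sdiff_subset (s := B) (t := A))]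

/-- A set of positive measure belongs to an ultrafilter all of whose members have positive
measure. -/
theorem exists_ultrafilter_forall_mem_pos (hempty : m ∅ = 0) (hnonneg : ∀ A : Set α, 0 ≤ m A)
    (hadd : ∀ A B : Set α, Disjoint A B → m (A ∪ B) = m A + m B)
    {A : Set α} (hA : 0 < m A) :
    ∃ U : Ultrafilter α, (∀ V ∈ U, 0 < m V) ∧ A ∈ U := by
  let F : Filter α := comk (fun s => m s = 0) hempty
    (fun _ ht _ hst => le_antisymm (ht ▸ finitelyAdditive_mono hnonneg hadd hst) (hnonneg _))
    (fun _ hs _ ht => finitelyAdditive_union_null hnonneg hadd hs ht)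
  have hF : NeBot (F ⊓ 𝓟 A) := by
    rw [neBot_iff, Ne, inf_principal_eq_bot]
    exact fun h => hA.ne' (compl_mem_comk.1 h)
  obtain ⟨U, hU⟩ := Ultrafilter.exists_le (F ⊓ 𝓟 A)
  refine ⟨U, fun V hV => (hnonneg V).lt_of_ne' fun h => ?_,
    le_principal_iff.1 (hU.trans inf_le_right)⟩
  exact Ultrafilter.compl_mem_iff_notMem.1 (hU.trans inf_le_left (compl_mem_comk.2 h)) hV

end FinitelyAdditive

theorem omegaSet_subset_iff_diff_null {m : Set ℕ → ℝ} (hempty : m ∅ = 0)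
    (hnonneg : ∀ A : Set ℕ, 0 ≤ m A)
    (hadd : ∀ A B : Set ℕ, Disjoint A B → m (A ∪ B) = m A + m B) {X Y : Set ℕ} :
    OmegaSet m X ⊆ OmegaSet m Y ↔ m (X \ Y) = 0 := by
  constructor
  · intro h
    by_contra hne
    obtain ⟨U, hpos, hU⟩ :=
      exists_ultrafilter_forall_mem_pos hempty hnonneg hadd ((hnonneg _).lt_of_ne' hne)
    have hY := (h ⟨hpos, mem_of_superset hU Set.sdiff_subset⟩).2
    have hlt := hpos _ (inter_mem hU hY)
    rw [Set.sdiff_inter_self, hempty] at hlt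
    exact lt_irrefl _ hlt
  · rintro h U ⟨hpos, hX⟩
    refine ⟨hpos, by_contra fun hY => ?_⟩
    exact (hpos _ (inter_mem hX (Ultrafilter.compl_mem_iff_notMem.2 hY))).ne' h

/-- `Ω[X] = Ω[Y]` if and only if the symmetric difference `X △ Y` is `m`-null,
for a finitely additive probability measure `m` on subsets of `ℕ`. -/
theorem omegaSet_eq_iff_symmDiff_null
    (m : Set ℕ → ℝ)
    (hempty : m ∅ = 0) (huniv : m Set.univ = 1)
    (hnonneg : ∀ A : Set ℕ, 0 ≤ m A)
    (hadd : ∀ A B : Set ℕ, Disjoint A B → m (A ∪ B) = m A + m B)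
    (X Y : Set ℕ) :
    OmegaSet m X = OmegaSet m Y ↔ m (symmDiff X Y) = 0 := by
  rw [Set.Subset.antisymm_iff, omegaSet_subset_iff_diff_null hempty hnonneg hadd,
    omegaSet_subset_iff_diff_null hempty hnonneg hadd, Set.symmDiff_def,
    hadd _ _ disjoint_sdiff_sdiff, add_eq_zero_iff_of_nonneg (hnonneg _) (hnonneg _)]
end

section
/- Let m : Set ℕ → ℝ be a finitely additive probability measure on all subsets of ℕ: m(∅) = 0, m(ℕ) = 1, m(A) ≥ 0 for all A, and m(A ∪ B) = m(A) + m(B) whenever A and B are disjoint. Let Ω = {U : ultrafilter on ℕ | m(V) > 0 for every V ∈ U} and Ω[X] = {U ∈ Ω | X ∈ U}. Let X ⊆ ℕ and X₁, X₂, … ⊆ ℕ be such that the sets Ω[X₁], Ω[X₂], … are pairwise disjoint and Ω[X] = ⋃_{n} Ω[Xₙ]. Then m(Xₙ) = 0 for all but finitely many n, i.e. the set {n | m(Xₙ) > 0} is finite. -/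
open Filter

section OmegaSet

variable {m : Set ℕ → ℝ}

theorem mono_of_additive (hnonneg : ∀ A : Set ℕ, 0 ≤ m A)
    (hadd : ∀ A B : Set ℕ, Disjoint A B → m (A ∪ B) = m A + m B)
    {A B : Set ℕ} (hAB : A ⊆ B) : m A ≤ m B := by
  have h := hadd A (B \ A) Set.disjoint_sdiff_right
  rw [Set.union_sdiff_cancel hAB] at h
  linarith [hnonneg (B \ A)]

/-- The filter of sets with `m`-null complement. -/
def conullFilter (hempty : m ∅ = 0) (hnonneg : ∀ A : Set ℕ, 0 ≤ m A)
    (hadd : ∀ A B : Set ℕ, Disjoint A B → m (A ∪ B) = m A + m B) : Filter ℕ where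
  sets := {A | m Aᶜ = 0}
  univ_sets := by simpa using hempty
  sets_of_superset {A B} hA hAB := by
    have hle := mono_of_additive hnonneg hadd (Set.compl_subset_compl.2 hAB)
    exact le_antisymm (hle.trans_eq hA) (hnonneg _)
  inter_sets {A B} hA hB := by
    have hle := mono_of_additive hnonneg hadd (Set.sdiff_subset : Bᶜ \ Aᶜ ⊆ Bᶜ)
    have hsum := hadd Aᶜ (Bᶜ \ Aᶜ) Set.disjoint_sdiff_right
    rw [Set.union_sdiff_self, ← Set.compl_inter] at hsum
    simp only [Set.mem_ofPred_eq] at hA hB ⊢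
    linarith [hnonneg (Bᶜ \ Aᶜ)]

theorem OmegaSet.nonempty (hempty : m ∅ = 0) (hnonneg : ∀ A : Set ℕ, 0 ≤ m A)
    (hadd : ∀ A B : Set ℕ, Disjoint A B → m (A ∪ B) = m A + m B)
    {Y : Set ℕ} (hY : 0 < m Y) : (OmegaSet m Y).Nonempty := by
  set F := conullFilter hempty hnonneg hadd
  have hF : (F ⊓ 𝓟 Y).NeBot := by
    refine ⟨fun hbot => ?_⟩
    rw [← compl_compl Y, ← mem_iff_inf_principal_compl] at hbot
    have hnull : m Yᶜᶜ = 0 := hbot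
    rw [compl_compl] at hnull
    exact hY.ne' hnull
  have hle : (Ultrafilter.of (F ⊓ 𝓟 Y) : Filter ℕ) ≤ F ⊓ 𝓟 Y := Ultrafilter.of_le _
  refine ⟨Ultrafilter.of (F ⊓ 𝓟 Y), fun V hV => (hnonneg V).lt_of_ne' fun hnull => ?_,
    hle (mem_inf_of_right (mem_principal_self Y))⟩
  have hcompl : Vᶜ ∈ F := by
    change m Vᶜᶜ = 0
    rwa [compl_compl]
  exact Ultrafilter.compl_mem_iff_notMem.1 (hle (mem_inf_of_left hcompl)) hV

theorem OmegaSet.isClosed (hnonneg : ∀ A : Set ℕ, 0 ≤ m A) (X : Set ℕ) :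
    IsClosed (OmegaSet m X) := by
  have h : OmegaSet m X =
      (⋂ V ∈ {V | m V = 0}, {U : Ultrafilter ℕ | Vᶜ ∈ U}) ∩ {U | X ∈ U} := by
    ext U
    simp only [OmegaSet, Set.mem_ofPred_eq, Set.mem_inter_iff, Set.mem_iInter,
      Ultrafilter.compl_mem_iff_notMem, Ultrafilter.mem_coe]
    exact and_congr_left fun _ => ⟨fun hpos V hV hVU => (hpos V hVU).ne' hV,
      fun hnull V hVU => (hnonneg V).lt_of_ne' fun hV => hnull V hV hVU⟩
  rw [h]
  exact (isClosed_biInter fun V _ => ultrafilter_isClosed_basic Vᶜ).inter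
    (ultrafilter_isClosed_basic X)

end OmegaSet

/-- If `Ω[X]` is partitioned into the pairwise disjoint sets `Ω[Xₙ]`, then all
but finitely many of the `Xₙ` are `m`-null. -/
theorem finitely_many_positive_of_omegaSet_partition
    (m : Set ℕ → ℝ)
    (hempty : m ∅ = 0) (huniv : m Set.univ = 1)
    (hnonneg : ∀ A : Set ℕ, 0 ≤ m A)
    (hadd : ∀ A B : Set ℕ, Disjoint A B → m (A ∪ B) = m A + m B)
    (X : Set ℕ) (Xs : ℕ → Set ℕ)
    (hdisj : ∀ i j, i ≠ j → Disjoint (OmegaSet m (Xs i)) (OmegaSet m (Xs j)))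
    (hunion : OmegaSet m X = ⋃ n, OmegaSet m (Xs n)) :
    {n | 0 < m (Xs n)}.Finite := by
  obtain ⟨t, ht⟩ := (OmegaSet.isClosed hnonneg X).isCompact.elim_finite_subcover
    (fun n => {U : Ultrafilter ℕ | Xs n ∈ U}) (fun n => ultrafilter_isOpen_basic (Xs n))
    (hunion.subset.trans (Set.iUnion_mono fun _ _ hU => hU.2))
  refine t.finite_toSet.subset fun n hn => ?_
  obtain ⟨U, hU⟩ := OmegaSet.nonempty hempty hnonneg hadd hn
  obtain ⟨i, hi, hUi⟩ := Set.mem_iUnion₂.1 (ht (hunion.superset (Set.mem_iUnion_of_mem n hU)))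
  by_cases hin : i = n
  · exact hin ▸ hi
  · exact (Set.disjoint_left.1 (hdisj i n hin) ⟨hU.1, hUi⟩ hU).elim
end

section
/- Let m : Set ℕ → ℝ be a finitely additive probability measure on all subsets of ℕ: m(∅) = 0, m(ℕ) = 1, m(A) ≥ 0 for all A, and m(A ∪ B) = m(A) + m(B) whenever A and B are disjoint. Let Ω = {U : ultrafilter on ℕ | m(V) > 0 for every V ∈ U} and Ω[X] = {U ∈ Ω | X ∈ U}. Let X ⊆ ℕ and X₁, X₂, … ⊆ ℕ be such that the sets Ω[X₁], Ω[X₂], … are pairwise disjoint and Ω[X] = ⋃_{n} Ω[Xₙ]. Then the family (m(Xₙ))ₙ is summable and m(X) = ∑'_{n} m(Xₙ). -/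
open Filter

section FinitelyAdditive

variable {m : Set ℕ → ℝ}

theorem measure_inter_add_diff_of_additive
    (hadd : ∀ A B : Set ℕ, Disjoint A B → m (A ∪ B) = m A + m B) (A B : Set ℕ) :
    m (A ∩ B) + m (A \ B) = m A := by
  rw [← hadd _ _ Set.disjoint_sdiff_inter.symm, Set.inter_union_sdiff]

theorem measure_le_of_diff_null (hnonneg : ∀ A : Set ℕ, 0 ≤ m A)
    (hadd : ∀ A B : Set ℕ, Disjoint A B → m (A ∪ B) = m A + m B) {A B : Set ℕ}
    (h : m (A \ B) = 0) : m A ≤ m B := by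
  have hA := measure_inter_add_diff_of_additive hadd A B
  have hB := measure_inter_add_diff_of_additive hadd B A
  rw [Set.inter_comm] at hB
  linarith [hnonneg (B \ A)]

theorem measure_null_of_subset_union (hnonneg : ∀ A : Set ℕ, 0 ≤ m A)
    (hadd : ∀ A B : Set ℕ, Disjoint A B → m (A ∪ B) = m A + m B) {A B C : Set ℕ}
    (hA : m A = 0) (hB : m B = 0) (h : C ⊆ A ∪ B) : m C = 0 := by
  have hempty : m ∅ = 0 := by simpa using hadd ∅ ∅ (by simp)
  have hle : ∀ {D E : Set ℕ}, D ⊆ E → m D ≤ m E := fun hDE =>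
    measure_le_of_diff_null hnonneg hadd (by rwa [Set.sdiff_eq_empty.2 hDE])
  have h₁ := measure_inter_add_diff_of_additive hadd C A
  have h₂ : m (C ∩ A) ≤ m A := hle Set.inter_subset_right
  have h₃ : m (C \ A) ≤ m B := hle (Set.sdiff_subset_iff.2 h)
  linarith [hnonneg C]

/-- Compactness: a countable cover of `Ω[A]` by sets `Ω[Yₙ]` has a finite subcover, up to a
null set. -/
theorem exists_diff_null_of_omegaSet_subset_iUnion (hnonneg : ∀ A : Set ℕ, 0 ≤ m A)
    (hadd : ∀ A B : Set ℕ, Disjoint A B → m (A ∪ B) = m A + m B) (A : Set ℕ) (Y : ℕ → Set ℕ)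
    (hsub : OmegaSet m A ⊆ ⋃ n, OmegaSet m (Y n)) :
    ∃ N, m (A \ ⋃ i ∈ Finset.range N, Y i) = 0 := by
  have hempty : m ∅ = 0 := by simpa using hadd ∅ ∅ (by simp)
  let G : Filter ℕ :=
    { sets := {V | ∃ N, m ((A \ V) \ ⋃ i ∈ Finset.range N, Y i) = 0}
      univ_sets := ⟨0, by simpa using hempty⟩
      sets_of_superset := by
        rintro V W ⟨N, hN⟩ hVW
        refine ⟨N, measure_null_of_subset_union hnonneg hadd hN hN ?_⟩
        rw [Set.union_self]
        exact Set.sdiff_subset_sdiff_left (Set.sdiff_subset_sdiff_right hVW)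
      inter_sets := by
        rintro V W ⟨N, hN⟩ ⟨M, hM⟩
        refine ⟨max N M, measure_null_of_subset_union hnonneg hadd hN hM ?_⟩
        rintro x ⟨⟨hxA, hxVW⟩, hx⟩
        simp only [Finset.mem_range, Set.mem_iUnion, not_exists, lt_max_iff] at hx
        by_cases hxV : x ∈ V
        · refine Or.inr ⟨⟨hxA, fun hxW => hxVW ⟨hxV, hxW⟩⟩, ?_⟩
          simpa using fun i hi => hx i (Or.inr hi)
        · refine Or.inl ⟨⟨hxA, hxV⟩, ?_⟩
          simpa using fun i hi => hx i (Or.inl hi) }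
  have mem_G : ∀ V, V ∈ G ↔ ∃ N, m ((A \ V) \ ⋃ i ∈ Finset.range N, Y i) = 0 :=
    fun _ => Iff.rfl
  rcases eq_or_neBot G with hG | hG
  · simpa using (mem_G ∅).1 (Filter.empty_mem_iff_bot.2 hG)
  · exfalso
    have hle : (Ultrafilter.of G : Filter ℕ) ≤ G := Ultrafilter.of_le G
    have hmem : Ultrafilter.of G ∈ OmegaSet m A := by
      refine ⟨fun V hV => (hnonneg V).lt_of_ne' fun hV₀ => ?_,
        hle ((mem_G A).2 ⟨0, by simpa using hempty⟩)⟩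
      refine Ultrafilter.compl_mem_iff_notMem.1 (hle ((mem_G Vᶜ).2 ⟨0, ?_⟩)) hV
      refine measure_null_of_subset_union hnonneg hadd hV₀ hV₀ fun x hx => ?_
      simpa using hx.1.2
    obtain ⟨n, -, hn⟩ := Set.mem_iUnion.1 (hsub hmem)
    refine Ultrafilter.compl_mem_iff_notMem.1 (hle ((mem_G (Y n)ᶜ).2 ⟨n + 1, ?_⟩)) hn
    convert hempty
    refine Set.sdiff_eq_empty.2 fun x hx => ?_
    exact Set.mem_biUnion (Finset.mem_coe.2 (Finset.self_mem_range_succ n)) (by simpa using hx.2)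

theorem measure_null_of_omegaSet_eq_empty (hnonneg : ∀ A : Set ℕ, 0 ≤ m A)
    (hadd : ∀ A B : Set ℕ, Disjoint A B → m (A ∪ B) = m A + m B) {A : Set ℕ}
    (h : OmegaSet m A = ∅) : m A = 0 := by
  obtain ⟨N, hN⟩ := exists_diff_null_of_omegaSet_subset_iUnion hnonneg hadd A (fun _ => ∅)
    (by simp [h])
  simpa using hN

theorem measure_biUnion_range_of_inter_null
    (hadd : ∀ A B : Set ℕ, Disjoint A B → m (A ∪ B) = m A + m B) (Y : ℕ → Set ℕ)
    (hY : ∀ n, m (Y n ∩ ⋃ i ∈ Finset.range n, Y i) = 0) (N : ℕ) :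
    m (⋃ i ∈ Finset.range N, Y i) = ∑ i ∈ Finset.range N, m (Y i) := by
  induction N with
  | zero => simpa using hadd ∅ ∅ (by simp)
  | succ n ih =>
    rw [Finset.sum_range_succ, ← ih, Finset.range_add_one, Finset.set_biUnion_insert,
      ← measure_inter_add_diff_of_additive hadd (Y n) (⋃ i ∈ Finset.range n, Y i), hY, zero_add,
      ← hadd _ _ Set.disjoint_sdiff_right, Set.union_sdiff_self, Set.union_comm]

theorem measure_inter_biUnion_range_null (hnonneg : ∀ A : Set ℕ, 0 ≤ m A)
    (hadd : ∀ A B : Set ℕ, Disjoint A B → m (A ∪ B) = m A + m B) (B : Set ℕ) (Y : ℕ → Set ℕ)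
    (N : ℕ) (h : ∀ i < N, m (B ∩ Y i) = 0) : m (B ∩ ⋃ i ∈ Finset.range N, Y i) = 0 := by
  induction N with
  | zero => simpa using hadd ∅ ∅ (by simp)
  | succ n ih =>
    refine measure_null_of_subset_union hnonneg hadd (h n n.lt_succ_self)
      (ih fun i hi => h i (hi.trans n.lt_succ_self)) ?_
    rw [Finset.range_add_one, Finset.set_biUnion_insert, Set.inter_union_distrib_left]

end FinitelyAdditive

/-- σ-additivity on the Boolean algebra `{Ω[X] : X ⊆ ℕ}`: if `Ω[X]` is
partitioned into the pairwise disjoint sets `Ω[Xₙ]`, then `(m (Xₙ))ₙ` is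
summable with sum `m X`. -/
theorem measure_sigma_additive_on_omegaSets
    (m : Set ℕ → ℝ)
    (hempty : m ∅ = 0) (huniv : m Set.univ = 1)
    (hnonneg : ∀ A : Set ℕ, 0 ≤ m A)
    (hadd : ∀ A B : Set ℕ, Disjoint A B → m (A ∪ B) = m A + m B)
    (X : Set ℕ) (Xs : ℕ → Set ℕ)
    (hdisj : ∀ i j, i ≠ j → Disjoint (OmegaSet m (Xs i)) (OmegaSet m (Xs j)))
    (hunion : OmegaSet m X = ⋃ n, OmegaSet m (Xs n)) :
    Summable (fun n => m (Xs n)) ∧ m X = ∑' n, m (Xs n) := by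
  have hinter : ∀ i j, i ≠ j → m (Xs i ∩ Xs j) = 0 := fun i j hij =>
    measure_null_of_omegaSet_eq_empty hnonneg hadd <| Set.eq_empty_of_forall_notMem
      fun U hU => Set.disjoint_left.1 (hdisj i j hij)
        ⟨hU.1, mem_of_superset hU.2 Set.inter_subset_left⟩
        ⟨hU.1, mem_of_superset hU.2 Set.inter_subset_right⟩
  have hdiff : ∀ i, m (Xs i \ X) = 0 := fun i =>
    measure_null_of_omegaSet_eq_empty hnonneg hadd <| Set.eq_empty_of_forall_notMem fun U hU => by
      have hUX : U ∈ OmegaSet m X := hunion ▸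
        Set.mem_iUnion.2 ⟨i, hU.1, mem_of_superset hU.2 Set.sdiff_subset⟩
      exact Ultrafilter.compl_mem_iff_notMem.1
        (mem_of_superset hU.2 fun x hx => hx.2) hUX.2
  obtain ⟨N, hN⟩ := exists_diff_null_of_omegaSet_subset_iUnion hnonneg hadd X Xs hunion.subset
  have hinterU : ∀ n M, M ≤ n → m (Xs n ∩ ⋃ i ∈ Finset.range M, Xs i) = 0 := fun n M hM =>
    measure_inter_biUnion_range_null hnonneg hadd _ _ _ fun i hi => hinter n i (by omega)
  have hUdiff : m ((⋃ i ∈ Finset.range N, Xs i) \ X) = 0 := by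
    rw [Set.sdiff_eq, Set.inter_comm]
    exact measure_inter_biUnion_range_null hnonneg hadd _ _ _ fun i _ => by
      rw [Set.inter_comm, ← Set.sdiff_eq, hdiff]
  have hX : m X = ∑ i ∈ Finset.range N, m (Xs i) := by
    rw [← measure_biUnion_range_of_inter_null hadd Xs (fun n => hinterU n n le_rfl)]
    exact (measure_le_of_diff_null hnonneg hadd hN).antisymm
      (measure_le_of_diff_null hnonneg hadd hUdiff)
  have htail : ∀ n ∉ Finset.range N, m (Xs n) = 0 := by
    intro n hn
    have hnX : m (Xs n \ ⋃ i ∈ Finset.range N, Xs i) = 0 :=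
      measure_null_of_subset_union hnonneg hadd (hdiff n) hN fun x hx => by
        by_cases hxX : x ∈ X
        · exact Or.inr ⟨hxX, hx.2⟩
        · exact Or.inl ⟨hx.1, hxX⟩
    rw [← measure_inter_add_diff_of_additive hadd (Xs n) (⋃ i ∈ Finset.range N, Xs i), hnX,
      hinterU n N (by simpa using hn), add_zero]
  have hsum : HasSum (fun n => m (Xs n)) (m X) := hX ▸ hasSum_sum_of_ne_finset_zero htail
  exact ⟨hsum.summable, hsum.tsum_eq.symm⟩
end

section
/- Let s : ℕ → ℝ with s(i) ∈ {-1,1} for all i, let n₀ ∈ ℕ, and let g : ℕ → ℕ be strictly monotone on the set {n : n ≥ n₀}. Assume the range of g has positive density in the sense that liminf_{N→∞} |{n : n ≥ n₀ and g(n) < N}| / N > 0. Let f : ℕ → ℝ with f(n) ∈ {-1,1} for all n, and let f' : ℕ → ℝ satisfy f'(g(n)) = f(n) for all n ≥ n₀ and f'(m) = 0 for every m not of the form g(n) with n ≥ n₀. If (∑_{m<N} f'(m)·s(m))/N → 0 as N → ∞, then (∑_{i<n} f(i)·s(g(i)))/n → 0 as n → ∞. -/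
open Filter Topology

/-- A sum over `[0, g n)` of a function supported on the range of `g` on `[n₀, ∞)`, for `g` strictly
monotone there, is the sum over `[n₀, n)` of the composition with `g`. -/
theorem sum_range_eq_sum_Ico_comp_of_strictMonoOn {M : Type*} [AddCommMonoid M] {n₀ : ℕ} {g : ℕ → ℕ}
    (hg : StrictMonoOn g {n | n₀ ≤ n}) {F : ℕ → M}
    (hF : ∀ m, (¬ ∃ n, n₀ ≤ n ∧ g n = m) → F m = 0) {n : ℕ} (hn : n₀ ≤ n) :
    ∑ i ∈ Finset.range (g n), F i = ∑ k ∈ Finset.Ico n₀ n, F (g k) := by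
  rw [← Finset.sum_image (f := F) (g := g) fun a ha b hb hab =>
    hg.injOn (Finset.mem_Ico.1 ha).1 (Finset.mem_Ico.1 hb).1 hab]
  symm
  apply Finset.sum_subset
  · intro m hm
    obtain ⟨k, hk, rfl⟩ := Finset.mem_image.1 hm
    rw [Finset.mem_Ico] at hk
    exact Finset.mem_range.2 (hg hk.1 hn hk.2)
  · intro m hm hm'
    refine hF m ?_
    rintro ⟨k, hk, rfl⟩
    exact hm' (Finset.mem_image_of_mem g
      (Finset.mem_Ico.2 ⟨hk, (hg.lt_iff_lt hk hn).1 (Finset.mem_range.1 hm)⟩))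

/-- If `g` is strictly monotone on `[n₀, ∞)`, exactly `n - n₀` of its values there lie below
`g n`. -/
theorem ncard_lt_of_strictMonoOn {n₀ : ℕ} {g : ℕ → ℕ}
    (hg : StrictMonoOn g {n | n₀ ≤ n}) {n : ℕ} (hn : n₀ ≤ n) :
    {k | n₀ ≤ k ∧ g k < g n}.ncard = n - n₀ := by
  have hset : {k | n₀ ≤ k ∧ g k < g n} = (Finset.Ico n₀ n : Set ℕ) := by
    ext k
    simp only [Set.mem_ofPred_eq, Finset.coe_Ico, Set.mem_Ico]
    exact and_congr_right fun hk => hg.lt_iff_lt hk hn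
  rw [hset, Set.ncard_coe_finset, Nat.card_Ico]

theorem tendsto_atTop_of_strictMonoOn {n₀ : ℕ} {g : ℕ → ℕ}
    (hg : StrictMonoOn g {n | n₀ ≤ n}) : Tendsto g atTop atTop := by
  have hmono : StrictMono fun k => g (k + n₀) := fun a b hab =>
    hg (Nat.le_add_left n₀ a) (Nat.le_add_left n₀ b) (Nat.add_lt_add_right hab n₀)
  exact (tendsto_add_atTop_iff_nat n₀).1 hmono.tendsto_atTop

/-- If the range of `g` on `[n₀, ∞)` has positive lower density, then `g` grows at most linearly. -/
theorem exists_eventually_div_le_of_liminf_pos {n₀ : ℕ} {g : ℕ → ℕ}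
    (hg : StrictMonoOn g {n | n₀ ≤ n})
    (hdens : 0 < Filter.liminf
      (fun N => (({n | n₀ ≤ n ∧ g n < N}.ncard : ℝ) / (N : ℝ))) atTop) :
    ∃ C : ℝ, ∀ᶠ n : ℕ in atTop, (g n : ℝ) / n ≤ C := by
  obtain ⟨c, hc, hcd⟩ := exists_between hdens
  have hbdd : IsBoundedUnder (· ≥ ·) atTop
      (fun N : ℕ => (({n | n₀ ≤ n ∧ g n < N}.ncard : ℝ) / (N : ℝ))) :=
    isBoundedUnder_of ⟨0, fun N => by positivity⟩
  have hev := (tendsto_atTop_of_strictMonoOn hg).eventually (eventually_lt_of_lt_liminf hcd hbdd)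
  refine ⟨c⁻¹, ?_⟩
  filter_upwards [hev, eventually_ge_atTop n₀, eventually_gt_atTop 0] with n hcn hn hn0
  rw [ncard_lt_of_strictMonoOn hg hn] at hcn
  have hgn : (0 : ℝ) < g n := by
    refine (Nat.cast_nonneg _).lt_of_ne fun h0 => ?_
    rw [← h0, div_zero] at hcn
    exact hc.not_gt hcn
  have hle : ((n - n₀ : ℕ) : ℝ) ≤ n := by exact_mod_cast Nat.sub_le n n₀
  have hn0' : (0 : ℝ) < n := by exact_mod_cast hn0
  rw [lt_div_iff₀ hgn] at hcn
  rw [div_le_iff₀ hn0', inv_mul_eq_div, le_div_iff₀ hc]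
  linarith

/-- Transport of pseudorandomness along a map `g` that is strictly monotone on
`[n₀, ∞)` with range of positive lower density: if the transported test `f'`
is uncorrelated with `s`, then the original test `f` is uncorrelated with
`s ∘ g`. -/
theorem pseudorandom_comp_of_strictMonoOn
    (s : ℕ → ℝ) (hs : ∀ i, s i = -1 ∨ s i = 1)
    (n₀ : ℕ) (g : ℕ → ℕ) (hg : StrictMonoOn g {n | n₀ ≤ n})
    (hdens : 0 < Filter.liminf
      (fun N => (({n | n₀ ≤ n ∧ g n < N}.ncard : ℝ) / (N : ℝ))) atTop)
    (f : ℕ → ℝ) (hf : ∀ n, f n = -1 ∨ f n = 1)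
    (f' : ℕ → ℝ)
    (hf'1 : ∀ n, n₀ ≤ n → f' (g n) = f n)
    (hf'2 : ∀ m, (¬ ∃ n, n₀ ≤ n ∧ g n = m) → f' m = 0)
    (h : Tendsto (fun N => (∑ i ∈ Finset.range N, f' i * s i) / (N : ℝ)) atTop (𝓝 0)) :
    Tendsto (fun n => (∑ i ∈ Finset.range n, f i * s (g i)) / (n : ℝ)) atTop (𝓝 0) := by
  obtain ⟨C, hC⟩ := exists_eventually_div_le_of_liminf_pos hg hdens
  have hgtop := tendsto_atTop_of_strictMonoOn hg
  have hhead : Tendsto (fun n : ℕ => (∑ i ∈ Finset.range n₀, f i * s (g i)) / (n : ℝ))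
      atTop (𝓝 0) := tendsto_const_div_atTop_nhds_zero_nat _
  have hratio : IsBoundedUnder (· ≤ ·) atTop (norm ∘ fun n : ℕ => (g n : ℝ) / n) := by
    refine ⟨C, eventually_map.2 (hC.mono fun n hn => ?_)⟩
    rwa [Function.comp_apply, Real.norm_of_nonneg (by positivity)]
  have htail := (h.comp hgtop).zero_mul_isBoundedUnder_le hratio
  rw [← add_zero (0 : ℝ)]
  refine (hhead.add htail).congr' ?_
  filter_upwards [eventually_ge_atTop n₀, hgtop.eventually_gt_atTop 0] with n hn hgn
  have hgn' : (g n : ℝ) ≠ 0 := by exact_mod_cast hgn.ne'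
  have hsum : ∑ i ∈ Finset.range (g n), f' i * s i = ∑ k ∈ Finset.Ico n₀ n, f k * s (g k) := by
    rw [sum_range_eq_sum_Ico_comp_of_strictMonoOn hg
      (fun m hm => by rw [hf'2 m hm, zero_mul]) hn]
    exact Finset.sum_congr rfl fun k hk => by rw [hf'1 k (Finset.mem_Ico.1 hk).1]
  rw [Function.comp_apply, hsum, div_mul_div_cancel₀ hgn', ← add_div,
    Finset.sum_range_add_sum_Ico _ hn]
end
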